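/- (Lemma 4.1(ii)) Assume (h1), (h2), (h3) and let f satisfy (f1)–(f4). Let u ∈ X with u⁺ ≠ 0 and u⁻ ≠ 0, and define h^u(t,s) = J(t u⁺ + s u⁻) for t, s ≥ 0. Then there exists a unique pair (t₊, s₋) with t₊ > 0 and s₋ > 0 such that t₊ u⁺ + s₋ u⁻ ∈ M, i.e. such that ⟨J'(t₊u⁺ + s₋u⁻), u⁺⟩ = ⟨J'(t₊u⁺ + s₋u⁻), u⁻⟩ = 0; moreover (t₊, s₋) is the unique global maximum point of h^u on [0,∞) × [0,∞). -/

import Mathlib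

open MeasureTheory Filter

noncomputable section

namespace ZeroMass

/-- The ambient Euclidean space `ℝ^N`. -/
abbrev EN (N : ℕ) := EuclideanSpace ℝ (Fin N)

/-- The critical fractional Sobolev exponent `2*_α = 2N/(N-2α)`. -/
def critExp (N : ℕ) (α : ℝ) : ℝ := 2 * N / (N - 2 * α)

/-- The square of the Gagliardo seminorm `[u]²`. -/
def gagSq (N : ℕ) (α : ℝ) (u : EN N → ℝ) : ENNReal :=
  ∫⁻ p : EN N × EN N, ENNReal.ofReal ((u p.1 - u p.2) ^ 2 / ‖p.1 - p.2‖ ^ ((N : ℝ) + 2 * α))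

/-- The square of the full norm `‖u‖² = [u]² + ∫ V u²`. -/
def normSq {N : ℕ} (α : ℝ) (V : EN N → ℝ) (u : EN N → ℝ) : ENNReal :=
  gagSq N α u + ∫⁻ x, ENNReal.ofReal (V x * u x ^ 2)

/-- Membership in the space `X`. -/
def memX {N : ℕ} (α : ℝ) (V : EN N → ℝ) (u : EN N → ℝ) : Prop :=
  Measurable u ∧ normSq α V u < ⊤

/-- The norm of `X`, i.e. `‖u‖ = ([u]² + ∫ V u²)^{1/2}`. -/
def Xnorm {N : ℕ} (α : ℝ) (V : EN N → ℝ) (u : EN N → ℝ) : ℝ :=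
  ((normSq α V u).toReal) ^ (1 / 2 : ℝ)

/-- The primitive `F(t) = ∫₀ᵗ f(τ) dτ`. -/
def prim (f : ℝ → ℝ) (t : ℝ) : ℝ := ∫ τ in (0 : ℝ)..t, f τ

/-- The energy functional `J`. -/
def Jfun {N : ℕ} (α : ℝ) (V K : EN N → ℝ) (f : ℝ → ℝ) (u : EN N → ℝ) : ℝ :=
  (1 / 2) * (normSq α V u).toReal - ∫ x, K x * prim f (u x)

/-- The pairing `⟨J'(u), φ⟩`. -/
def Jd {N : ℕ} (α : ℝ) (V K : EN N → ℝ) (f : ℝ → ℝ) (u φ : EN N → ℝ) : ℝ :=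
  (∫ p : EN N × EN N, (u p.1 - u p.2) * (φ p.1 - φ p.2) / ‖p.1 - p.2‖ ^ ((N : ℝ) + 2 * α))
    + (∫ x, V x * u x * φ x) - ∫ x, K x * f (u x) * φ x

/-- Positive part `u⁺ = max(u, 0)`. -/
def uplus {N : ℕ} (u : EN N → ℝ) : EN N → ℝ := fun x => max (u x) 0

/-- Negative part `u⁻ = min(u, 0)`. -/
def uminus {N : ℕ} (u : EN N → ℝ) : EN N → ℝ := fun x => min (u x) 0

/-- `u` is not almost everywhere zero. -/
def NotAEZero {N : ℕ} (u : EN N → ℝ) : Prop :=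
  ¬ (u =ᵐ[(volume : Measure (EN N))] (0 : EN N → ℝ))

/-- Hypothesis (h1): `V, K > 0` everywhere and `K` bounded. -/
def H1 {N : ℕ} (V K : EN N → ℝ) : Prop :=
  (∀ x, 0 < V x) ∧ (∀ x, 0 < K x) ∧ ∃ C : ℝ, ∀ x, K x ≤ C

/-- Hypothesis (h2): uniform vanishing of `∫_{A_n ∩ {|x| ≥ r}} K`. -/
def H2 {N : ℕ} (K : EN N → ℝ) : Prop :=
  ∀ (A : ℕ → Set (EN N)) (R : ℝ), 0 < R → (∀ n, MeasurableSet (A n)) →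
    (∀ n, volume (A n) ≤ ENNReal.ofReal R) →
    ∀ ε : ℝ, 0 < ε → ∃ r₀ : ℝ, ∀ r : ℝ, r₀ ≤ r → ∀ n,
      (∫⁻ x in A n ∩ {x : EN N | r ≤ ‖x‖}, ENNReal.ofReal (K x)) ≤ ENNReal.ofReal ε

/-- Hypothesis (h3): `K/V` is bounded. -/
def H3 {N : ℕ} (V K : EN N → ℝ) : Prop := ∃ C : ℝ, ∀ x, K x / V x ≤ C

/-- Hypothesis (h4) with exponent `m`. -/
def H4 {N : ℕ} (α : ℝ) (V K : EN N → ℝ) (m : ℝ) : Prop :=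
  2 < m ∧ m < critExp N α ∧
    Tendsto (fun x : EN N => K x / V x ^ ((critExp N α - m) / (critExp N α - 2)))
      (comap (fun x : EN N => ‖x‖) atTop) (nhds 0)

/-- Hypothesis (f1): `f(t)/|t| → 0` as `t → 0`. -/
def Cf1 (f : ℝ → ℝ) : Prop :=
  Tendsto (fun t : ℝ => f t / |t|) (nhdsWithin 0 {(0 : ℝ)}ᶜ) (nhds 0)

/-- Hypothesis (f̃1): `limsup_{t→0} f(t)/|t|^{m-1} < ∞`. -/
def Cf1' (f : ℝ → ℝ) (m : ℝ) : Prop :=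
  ∃ C : ℝ, ∀ᶠ t in nhdsWithin (0 : ℝ) {(0 : ℝ)}ᶜ, f t / |t| ^ (m - 1) ≤ C

/-- Hypothesis (f2) with exponent `p`: `f(t)/|t|^{p-1} → 0` as `|t| → ∞`. -/
def Cf2 (f : ℝ → ℝ) (p : ℝ) : Prop :=
  Tendsto (fun t : ℝ => f t / |t| ^ (p - 1)) (comap (fun t : ℝ => |t|) atTop) (nhds 0)

/-- Hypothesis (f3): `F(t)/t² → +∞` as `|t| → ∞`. -/
def Cf3 (f : ℝ → ℝ) : Prop :=
  Tendsto (fun t : ℝ => prim f t / t ^ 2) (comap (fun t : ℝ => |t|) atTop) atTop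

/-- Hypothesis (f4): `t ↦ f(t)/|t|` is strictly increasing on `ℝ \ {0}`. -/
def Cf4 (f : ℝ → ℝ) : Prop :=
  ∀ s t : ℝ, s ≠ 0 → t ≠ 0 → s < t → f s / |s| < f t / |t|

/-- Nehari manifold membership, formulated with the pairing `⟨J'(u), u⟩ = 0`. -/
def memNehari {N : ℕ} (α : ℝ) (V K : EN N → ℝ) (f : ℝ → ℝ) (u : EN N → ℝ) : Prop :=
  memX α V u ∧ NotAEZero u ∧ Jd α V K f u u = 0

/-- Nehari manifold membership, formulated as `‖u‖² = ∫ K f(u) u`. -/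
def memNehari2 {N : ℕ} (α : ℝ) (V K : EN N → ℝ) (f : ℝ → ℝ) (u : EN N → ℝ) : Prop :=
  memX α V u ∧ NotAEZero u ∧ (normSq α V u).toReal = ∫ x, K x * f (u x) * u x

/-- Nodal (sign-changing) Nehari set membership. -/
def memM {N : ℕ} (α : ℝ) (V K : EN N → ℝ) (f : ℝ → ℝ) (u : EN N → ℝ) : Prop :=
  memNehari α V K f u ∧ NotAEZero (uplus u) ∧ NotAEZero (uminus u) ∧
    Jd α V K f u (uplus u) = 0 ∧ Jd α V K f u (uminus u) = 0

/-- Weak convergence in `X` of the sequence `u` to `w`. -/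
def weakConv {N : ℕ} (α : ℝ) (V : EN N → ℝ) (u : ℕ → EN N → ℝ) (w : EN N → ℝ) : Prop :=
  ∀ v : EN N → ℝ, memX α V v →
    Tendsto (fun n =>
      (∫ p : EN N × EN N,
        ((u n p.1 - w p.1) - (u n p.2 - w p.2)) * (v p.1 - v p.2)
          / ‖p.1 - p.2‖ ^ ((N : ℝ) + 2 * α))
      + ∫ x, V x * (u n x - w x) * v x) atTop (nhds 0)

end ZeroMass

open ZeroMass

namespace ZeroMass

/-- Properties of the one-variable functions `t ↦ ∫ K F(t v)` and their derivatives. -/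
structure IsFiber (G g : ℝ → ℝ) : Prop where
  zero : G 0 = 0
  nonneg : ∀ t, 0 ≤ G t
  hasDerivAt : ∀ t, HasDerivAt G (g t) t
  strict_mono : ∀ t t', 0 < t → t < t' → g t / t < g t' / t'
  superquadratic : ∀ M : ℝ, ∃ T, ∀ t, T ≤ t → M * t ^ 2 ≤ G t
  subquadratic : ∀ ε : ℝ, 0 < ε → ∃ δ, 0 < δ ∧ ∀ t, 0 < t → t < δ → G t ≤ ε * t ^ 2

/-- The energy `J(t u⁺ + s u⁻)` as a function of `(t, s)`: `A = ‖u⁺‖²`, `B = ‖u⁻‖²`, `D` is the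
cross term and `G`, `H` are the nonlinear parts. -/
def fiberEnergy (A B D : ℝ) (G H : ℝ → ℝ) (t s : ℝ) : ℝ :=
  1 / 2 * (t ^ 2 * A + s ^ 2 * B + 2 * (t * s * D)) - G t - H s

/-- A critical pair is unique: the first coordinates of two critical pairs cannot be ordered. -/
lemma critical_not_lt {A B D : ℝ} (hD : 0 ≤ D) {G g H h : ℝ → ℝ}
    (hG : IsFiber G g) (hH : IsFiber H h) {t s t' s' : ℝ} (ht : 0 < t) (hs : 0 < s)
    (ht' : 0 < t') (hs' : 0 < s')
    (e1 : t * A + s * D = g t) (e2 : s * B + t * D = h s)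
    (e1' : t' * A + s' * D = g t') (e2' : s' * B + t' * D = h s') : ¬ t < t' := by
  intro hlt
  have h1 := hG.strict_mono t t' ht hlt
  rw [← e1, ← e1', div_lt_div_iff₀ ht ht'] at h1
  have h2 : D * (s * t' - s' * t) < 0 := by nlinarith
  have h3 : s * t' < s' * t := by
    by_contra hc
    exact absurd (mul_nonneg hD (sub_nonneg.2 (not_lt.1 hc))) (not_le.2 h2)
  have hss : s < s' := by
    have : s * t < s' * t := lt_of_le_of_lt (by nlinarith) h3
    exact lt_of_mul_lt_mul_right this ht.le
  have h4 := hH.strict_mono s s' hs hss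
  rw [← e2, ← e2', div_lt_div_iff₀ hs hs'] at h4
  nlinarith [mul_nonneg hD (sub_nonneg.2 h3.le)]

lemma critical_unique {A B D : ℝ} (hD : 0 ≤ D) {G g H h : ℝ → ℝ}
    (hG : IsFiber G g) (hH : IsFiber H h) {t s t' s' : ℝ} (ht : 0 < t) (hs : 0 < s)
    (ht' : 0 < t') (hs' : 0 < s')
    (e1 : t * A + s * D = g t) (e2 : s * B + t * D = h s)
    (e1' : t' * A + s' * D = g t') (e2' : s' * B + t' * D = h s') : t = t' ∧ s = s' :=
  ⟨le_antisymm (not_lt.1 (critical_not_lt hD hG hH ht' hs' ht hs e1' e2' e1 e2))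
      (not_lt.1 (critical_not_lt hD hG hH ht hs ht' hs' e1 e2 e1' e2')),
    le_antisymm (not_lt.1 (critical_not_lt hD hH hG hs' ht' hs ht e2' e1' e2 e1))
      (not_lt.1 (critical_not_lt hD hH hG hs ht hs' ht' e2 e1 e2' e1'))⟩

/-- Adding a small second component strictly raises the energy. -/
lemma exists_fiberEnergy_gt {A B D : ℝ} (hB : 0 < B) (hD : 0 ≤ D) {G H h : ℝ → ℝ}
    (hH : IsFiber H h) {t : ℝ} (ht : 0 ≤ t) :
    ∃ s, 0 < s ∧ fiberEnergy A B D G H t 0 < fiberEnergy A B D G H t s := by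
  obtain ⟨δ, hδ, hlt⟩ := hH.subquadratic (B / 4) (by positivity)
  refine ⟨δ / 2, by positivity, ?_⟩
  have := hlt (δ / 2) (by positivity) (by linarith)
  have h1 : 0 ≤ t * (δ / 2) * D := by positivity
  have h2 : 0 < B * (δ / 2) ^ 2 := by positivity
  simp only [fiberEnergy, hH.zero]
  nlinarith

lemma fiberEnergy_comm (A B D : ℝ) (G H : ℝ → ℝ) (t s : ℝ) :
    fiberEnergy A B D G H t s = fiberEnergy B A D H G s t := by
  simp only [fiberEnergy]; ring

lemma hasDerivAt_fiberEnergy (A B D : ℝ) {G g : ℝ → ℝ} (H : ℝ → ℝ) (hG : IsFiber G g) (t s : ℝ) :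
    HasDerivAt (fun t => fiberEnergy A B D G H t s) (t * A + s * D - g t) t := by
  have h1 : HasDerivAt (fun t : ℝ => 1 / 2 * (t ^ 2 * A + s ^ 2 * B + 2 * (t * s * D)))
      (t * A + s * D) t := by
    have h2 := ((((hasDerivAt_id t).pow 2).mul_const A).add_const (s ^ 2 * B)).add
      ((((hasDerivAt_id t).mul_const s).mul_const D).const_mul 2) |>.const_mul (1 / 2)
    refine h2.congr_deriv ?_
    simp only [id]
    ring
  exact (h1.sub (hG.hasDerivAt t)).sub_const (H s)

/-- A maximum point over the closed quadrant with positive first coordinate is critical in it. -/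
lemma critical_of_max {A B D : ℝ} {G g H : ℝ → ℝ} (hG : IsFiber G g) {t s : ℝ}
    (ht : 0 < t) (hs : 0 ≤ s)
    (hmax : ∀ t' s', 0 ≤ t' → 0 ≤ s' → fiberEnergy A B D G H t' s' ≤ fiberEnergy A B D G H t s) :
    t * A + s * D = g t := by
  have hloc : IsLocalMax (fun t => fiberEnergy A B D G H t s) t := by
    filter_upwards [lt_mem_nhds ht] with t' ht'
    exact hmax t' s ht'.le hs
  exact sub_eq_zero.1 (hloc.hasDerivAt_eq_zero (hasDerivAt_fiberEnergy A B D H hG t s))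

lemma exists_max_fiberEnergy {A B D : ℝ} (hA : 0 < A) (hB : 0 < B) (hD : 0 ≤ D) {G g H h : ℝ → ℝ}
    (hG : IsFiber G g) (hH : IsFiber H h) :
    ∃ t s, 0 ≤ t ∧ 0 ≤ s ∧ ∀ t' s', 0 ≤ t' → 0 ≤ s' →
      fiberEnergy A B D G H t' s' ≤ fiberEnergy A B D G H t s := by
  obtain ⟨T₁, hT₁⟩ := hG.superquadratic (A + B + 2 * D)
  obtain ⟨T₂, hT₂⟩ := hH.superquadratic (A + B + 2 * D)
  set T := max (max T₁ T₂) 0 with hT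
  have hT0 : 0 ≤ T := le_max_right _ _
  have hT1 : T₁ ≤ T := (le_max_left _ _).trans (le_max_left _ _)
  have hT2 : T₂ ≤ T := (le_max_right _ _).trans (le_max_left _ _)
  have hGc : Continuous G := continuous_iff_continuousAt.2 fun t => (hG.hasDerivAt t).continuousAt
  have hHc : Continuous H := continuous_iff_continuousAt.2 fun t => (hH.hasDerivAt t).continuousAt
  have hcont : Continuous fun p : ℝ × ℝ => fiberEnergy A B D G H p.1 p.2 := by
    unfold fiberEnergy
    fun_prop
  obtain ⟨p, hp, hpmax⟩ := (isCompact_Icc.prod isCompact_Icc :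
    IsCompact (Set.Icc (0 : ℝ) T ×ˢ Set.Icc (0 : ℝ) T)).exists_isMaxOn
      ⟨(0, 0), by simp [hT0]⟩ hcont.continuousOn
  have hp0 : 0 ≤ fiberEnergy A B D G H p.1 p.2 := by
    have := hpmax (show ((0 : ℝ), (0 : ℝ)) ∈ Set.Icc (0 : ℝ) T ×ˢ Set.Icc (0 : ℝ) T by simp [hT0])
    simpa [fiberEnergy, hG.zero, hH.zero] using this
  refine ⟨p.1, p.2, hp.1.1, hp.2.1, fun t s ht hs => ?_⟩
  by_cases hin : t ≤ T ∧ s ≤ T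
  · exact hpmax (show (t, s) ∈ Set.Icc (0 : ℝ) T ×ˢ Set.Icc (0 : ℝ) T from
      ⟨⟨ht, hin.1⟩, ⟨hs, hin.2⟩⟩)
  refine le_trans ?_ hp0
  have hGn := hG.nonneg t
  have hHn := hH.nonneg s
  have hcross : 0 ≤ (t - s) ^ 2 * D := by positivity
  unfold fiberEnergy
  rcases le_total t s with hts | hts
  · have hs' : T ≤ s := by
      by_contra hc
      exact hin ⟨by linarith, by linarith⟩
    have := hT₂ s (hT2.trans hs')
    have hsq : t ^ 2 ≤ s ^ 2 := by gcongr
    nlinarith [mul_le_mul_of_nonneg_right hsq hA.le, mul_le_mul_of_nonneg_right hsq hD,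
      mul_nonneg (sq_nonneg s) hA.le, mul_nonneg (sq_nonneg s) hB.le, mul_nonneg (sq_nonneg s) hD]
  · have ht' : T ≤ t := by
      by_contra hc
      exact hin ⟨by linarith, by linarith⟩
    have := hT₁ t (hT1.trans ht')
    have hsq : s ^ 2 ≤ t ^ 2 := by gcongr
    nlinarith [mul_le_mul_of_nonneg_right hsq hB.le, mul_le_mul_of_nonneg_right hsq hD,
      mul_nonneg (sq_nonneg t) hA.le, mul_nonneg (sq_nonneg t) hB.le, mul_nonneg (sq_nonneg t) hD]

/-- The energy on the quadrant has exactly one critical pair, and it is the strict maximum. -/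
lemma exists_unique_critical {A B D : ℝ} (hA : 0 < A) (hB : 0 < B) (hD : 0 ≤ D)
    {G g H h : ℝ → ℝ} (hG : IsFiber G g) (hH : IsFiber H h) :
    ∃ t s, 0 < t ∧ 0 < s ∧ t * A + s * D = g t ∧ s * B + t * D = h s ∧
      (∀ t' s', 0 < t' → 0 < s' → t' * A + s' * D = g t' → s' * B + t' * D = h s' →
        t' = t ∧ s' = s) ∧
      ∀ t' s', 0 ≤ t' → 0 ≤ s' → (t', s') ≠ (t, s) →
        fiberEnergy A B D G H t' s' < fiberEnergy A B D G H t s := by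
  have key : ∀ t s, 0 ≤ t → 0 ≤ s →
      (∀ t' s', 0 ≤ t' → 0 ≤ s' →
        fiberEnergy A B D G H t' s' ≤ fiberEnergy A B D G H t s) →
      0 < t ∧ 0 < s ∧ t * A + s * D = g t ∧ s * B + t * D = h s := by
    intro t s ht hs hmax
    have hs0 : 0 < s := by
      refine lt_of_le_of_ne hs fun h0 => ?_
      subst h0
      obtain ⟨s', hs', hlt⟩ := exists_fiberEnergy_gt (A := A) (G := G) hB hD hH ht
      exact absurd (hmax t s' ht hs'.le) (not_le.2 hlt)
    have ht0 : 0 < t := by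
      refine lt_of_le_of_ne ht fun h0 => ?_
      subst h0
      obtain ⟨t', ht', hlt⟩ := exists_fiberEnergy_gt (A := B) (G := H) hA hD hG hs
      rw [fiberEnergy_comm, fiberEnergy_comm B] at hlt
      exact absurd (hmax t' s ht'.le hs) (not_le.2 hlt)
    refine ⟨ht0, hs0, critical_of_max hG ht0 hs hmax,
      critical_of_max (A := B) (B := A) (H := G) hH hs0 ht fun s' t' hs' ht' => ?_⟩
    rw [fiberEnergy_comm B, fiberEnergy_comm B]
    exact hmax t' s' ht' hs'
  obtain ⟨t, s, ht, hs, hmax⟩ := exists_max_fiberEnergy hA hB hD hG hH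
  obtain ⟨ht0, hs0, e1, e2⟩ := key t s ht hs hmax
  have huniq : ∀ t' s', 0 < t' → 0 < s' → t' * A + s' * D = g t' → s' * B + t' * D = h s' →
      t' = t ∧ s' = s := fun t' s' ht' hs' e1' e2' =>
    critical_unique hD hG hH ht' hs' ht0 hs0 e1' e2' e1 e2
  refine ⟨t, s, ht0, hs0, e1, e2, huniq, fun t' s' ht' hs' hne => ?_⟩
  refine lt_of_le_of_ne (hmax t' s' ht' hs') fun heq => hne ?_
  obtain ⟨h1, h2, h3, h4⟩ := key t' s' ht' hs' fun t'' s'' h1 h2 => heq ▸ hmax t'' s'' h1 h2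
  obtain ⟨rfl, rfl⟩ := huniq t' s' h1 h2 h3 h4
  rfl

lemma pos_mul_self {f : ℝ → ℝ} (hf1 : Cf1 f) (hf4 : Cf4 f) {t : ℝ} (ht : t ≠ 0) :
    0 < f t * t := by
  rcases lt_or_gt_of_ne ht with h | h
  · have hlim : Tendsto (fun t : ℝ => f t / |t|) (nhdsWithin 0 (Set.Iio 0)) (nhds 0) :=
      hf1.mono_left (nhdsWithin_mono _ fun x hx => ne_of_lt hx)
    have h1 : f (t / 2) / |t / 2| ≤ 0 := by
      refine ge_of_tendsto hlim ?_
      filter_upwards [self_mem_nhdsWithin, nhdsWithin_le_nhds (lt_mem_nhds (show t / 2 < 0 by linarith))]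
        with x hx hx'
      exact (hf4 _ _ (by linarith) (ne_of_lt hx) hx').le
    have h2 := (hf4 t (t / 2) ht (by linarith) (by linarith)).trans_le h1
    have h3 : f t < 0 := by
      by_contra hc
      exact absurd h2 (not_lt.2 (div_nonneg (not_lt.1 hc) (abs_nonneg t)))
    exact mul_pos_of_neg_of_neg h3 h
  · have hlim : Tendsto (fun t : ℝ => f t / |t|) (nhdsWithin 0 (Set.Ioi 0)) (nhds 0) :=
      hf1.mono_left (nhdsWithin_mono _ fun x hx => ne_of_gt hx)
    have h1 : 0 ≤ f (t / 2) / |t / 2| := by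
      refine le_of_tendsto hlim ?_
      filter_upwards [self_mem_nhdsWithin, nhdsWithin_le_nhds (gt_mem_nhds (show 0 < t / 2 by linarith))]
        with x hx hx'
      exact (hf4 _ _ (ne_of_gt hx) (by linarith) hx').le
    have h2 := h1.trans_lt (hf4 (t / 2) t (by linarith) ht (by linarith))
    exact mul_pos ((div_pos_iff_of_pos_right (abs_pos.2 ht)).1 h2) h

lemma apply_zero {f : ℝ → ℝ} (hf : Continuous f) (hf1 : Cf1 f) (hf4 : Cf4 f) : f 0 = 0 := by
  apply le_antisymm
  · have : Tendsto f (nhdsWithin 0 (Set.Iio 0)) (nhds (f 0)) := hf.continuousWithinAt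
    refine le_of_tendsto this ?_
    filter_upwards [self_mem_nhdsWithin] with x hx
    have hx' : x < 0 := hx
    nlinarith [pos_mul_self hf1 hf4 hx'.ne]
  · have : Tendsto f (nhdsWithin 0 (Set.Ioi 0)) (nhds (f 0)) := hf.continuousWithinAt
    refine ge_of_tendsto this ?_
    filter_upwards [self_mem_nhdsWithin] with x hx
    have hx' : 0 < x := hx
    nlinarith [pos_mul_self hf1 hf4 hx'.ne']

lemma hasDerivAt_prim {f : ℝ → ℝ} (hf : Continuous f) (t : ℝ) : HasDerivAt (prim f) (f t) t :=
  intervalIntegral.integral_hasDerivAt_right (hf.intervalIntegrable _ _)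
    (hf.stronglyMeasurableAtFilter _ _) hf.continuousAt

lemma continuous_prim {f : ℝ → ℝ} (hf : Continuous f) : Continuous (prim f) :=
  continuous_iff_continuousAt.2 fun t => (hasDerivAt_prim hf t).continuousAt

lemma prim_nonneg {f : ℝ → ℝ} (hf : Continuous f) (hf1 : Cf1 f) (hf4 : Cf4 f) (t : ℝ) :
    0 ≤ prim f t := by
  have h0 := apply_zero hf hf1 hf4
  rcases le_total 0 t with h | h
  · refine intervalIntegral.integral_nonneg h fun τ hτ => ?_
    rcases hτ.1.eq_or_lt with h | h
    · rw [← h, h0]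
    · nlinarith [pos_mul_self hf1 hf4 h.ne']
  · unfold prim
    rw [intervalIntegral.integral_symm, ← intervalIntegral.integral_neg]
    refine intervalIntegral.integral_nonneg h fun τ hτ => ?_
    rcases hτ.2.eq_or_lt with h | h
    · rw [h, h0, neg_zero]
    · nlinarith [pos_mul_self hf1 hf4 h.ne]

/-- Growth bound `|f(t)| ≤ ε|t| + C|t|^{q-1}`. -/
lemma growth {f : ℝ → ℝ} {q : ℝ} (hf : Continuous f) (h0 : f 0 = 0)
    (hf1 : Cf1 f) (hf2 : Cf2 f q) {ε : ℝ} (hε : 0 < ε) :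
    ∃ C, 0 ≤ C ∧ ∀ t, |f t| ≤ ε * |t| + C * |t| ^ (q - 1) := by
  obtain ⟨δ, hδ, hδ'⟩ := Metric.mem_nhdsWithin_iff.1 (hf1 (Metric.ball_mem_nhds 0 hε))
  obtain ⟨R, hR⟩ := ((Filter.HasBasis.comap _ (atTop_basis)).mem_iff).1
    (hf2 (Metric.ball_mem_nhds 0 one_pos))
  obtain ⟨M, hM⟩ := (isCompact_Icc (a := -|R|) (b := |R|)).exists_bound_of_continuousOn
    hf.continuousOn
  have hcont : ContinuousOn (fun t : ℝ => t ^ (q - 1)) (Set.Icc δ (max δ |R|)) := fun t ht =>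
    (Real.continuousAt_rpow_const _ _ (Or.inl (by linarith [ht.1] : t ≠ 0))).continuousWithinAt
  obtain ⟨m, hm, hmin⟩ := isCompact_Icc.exists_isMinOn ⟨δ, by simp⟩ hcont
  have hm0 : 0 < m ^ (q - 1) := Real.rpow_pos_of_pos (by linarith [hm.1]) _
  refine ⟨1 + |M| / m ^ (q - 1), by positivity, fun t => ?_⟩
  have hpow : 0 ≤ |t| ^ (q - 1) := Real.rpow_nonneg (abs_nonneg _) _
  rcases eq_or_ne t 0 with rfl | ht
  · rw [h0, abs_zero]; positivity
  have htp := abs_pos.2 ht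
  rcases lt_or_ge |t| δ with h | h
  · have := hδ' (show t ∈ Metric.ball 0 δ ∩ {0}ᶜ from ⟨by simpa using h, ht⟩)
    simp only [Set.mem_preimage, Metric.mem_ball, dist_zero_right, Real.norm_eq_abs, abs_div,
      abs_abs] at this
    rw [div_lt_iff₀ htp] at this
    have : 0 ≤ (1 + |M| / m ^ (q - 1)) * |t| ^ (q - 1) := by positivity
    linarith
  have hε' : 0 ≤ ε * |t| := by positivity
  rcases le_or_gt |t| |R| with h' | h'
  · have h1 := hM t (abs_le.1 h')
    have h2 : m ^ (q - 1) ≤ |t| ^ (q - 1) := hmin (show |t| ∈ Set.Icc δ (max δ |R|) from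
      ⟨h, h'.trans (le_max_right _ _)⟩)
    have h3 : |M| ≤ |M| / m ^ (q - 1) * |t| ^ (q - 1) := by
      rw [div_mul_eq_mul_div, le_div_iff₀ hm0]
      gcongr
    rw [Real.norm_eq_abs] at h1
    nlinarith [le_abs_self M]
  · have := hR.2 (show t ∈ (fun t : ℝ => |t|) ⁻¹' Set.Ici R from (le_abs_self R).trans h'.le)
    simp only [Set.mem_preimage, Metric.mem_ball, dist_zero_right, Real.norm_eq_abs, abs_div,
      abs_of_nonneg hpow] at this
    rw [div_lt_one (Real.rpow_pos_of_pos htp _)] at this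
    have : 0 ≤ |M| / m ^ (q - 1) * |t| ^ (q - 1) := by positivity
    linarith

lemma abs_mul_rpow_sub_one {q : ℝ} (hq : q ≠ 0) (t : ℝ) : |t| ^ (q - 1) * |t| = |t| ^ q := by
  rcases eq_or_ne t 0 with rfl | ht
  · simp [Real.zero_rpow hq]
  · rw [Real.rpow_sub_one (abs_pos.2 ht).ne', div_mul_cancel₀ _ (abs_pos.2 ht).ne']

lemma prim_growth {f : ℝ → ℝ} {q : ℝ} (hq : 1 ≤ q) {ε C : ℝ} (hε : 0 ≤ ε) (hC : 0 ≤ C)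
    (hb : ∀ t, |f t| ≤ ε * |t| + C * |t| ^ (q - 1)) (t : ℝ) :
    |prim f t| ≤ ε * t ^ 2 + C * |t| ^ q := by
  have h1 : ∀ τ ∈ Set.uIoc 0 t, ‖f τ‖ ≤ ε * |t| + C * |t| ^ (q - 1) := by
    intro τ hτ
    have : |τ| ≤ |t| := by
      simpa using Set.abs_sub_left_of_mem_uIcc (Set.uIoc_subset_uIcc hτ)
    refine (hb τ).trans ?_
    gcongr
  have h2 := intervalIntegral.norm_integral_le_of_norm_le_const h1
  rw [Real.norm_eq_abs, sub_zero, add_mul, mul_assoc, mul_assoc,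
    abs_mul_rpow_sub_one (by linarith), ← sq, sq_abs] at h2
  exact h2

/-- `τ ↦ f(τ v) v / τ` is strictly increasing on `(0, ∞)` for `v ≠ 0`. -/
lemma fiber_strict_mono {f : ℝ → ℝ} (hf4 : Cf4 f) {v t t' : ℝ} (hv : v ≠ 0)
    (ht : 0 < t) (htt : t < t') : f (t * v) * v / t < f (t' * v) * v / t' := by
  have ht' := ht.trans htt
  have key : ∀ τ, 0 < τ → f (τ * v) * v / τ = f (τ * v) / |τ * v| * (v * |v|) := by
    intro τ hτ
    have := abs_pos.2 hv
    rw [abs_mul, abs_of_pos hτ]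
    field_simp
  rw [key t ht, key t' ht']
  rcases lt_or_gt_of_ne hv with h | h
  · have := hf4 (t' * v) (t * v) (by positivity) (by positivity) (by nlinarith)
    have h2 : v * |v| < 0 := mul_neg_of_neg_of_pos h (abs_pos.2 hv)
    nlinarith
  · have := hf4 (t * v) (t' * v) (by positivity) (by positivity) (by nlinarith)
    gcongr

section Fiber

variable {Ω : Type*} {K v : Ω → ℝ} {f : ℝ → ℝ} {q : ℝ}

lemma fiber_deriv_bound (hq : 1 < q) (hK : ∀ x, 0 < K x) {C : ℝ} (hC : 0 ≤ C)
    (hb : ∀ t, |f t| ≤ 1 * |t| + C * |t| ^ (q - 1)) {R t : ℝ} (ht : |t| ≤ R) (x : Ω) :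
    ‖K x * f (t * v x) * v x‖ ≤ R * (K x * v x ^ 2) + C * R ^ (q - 1) * (K x * |v x| ^ q) := by
  have hR : 0 ≤ R := (abs_nonneg t).trans ht
  have h1 : |f (t * v x)| ≤ R * |v x| + C * (R ^ (q - 1) * |v x| ^ (q - 1)) := by
    refine (hb _).trans ?_
    rw [abs_mul, one_mul, Real.mul_rpow (abs_nonneg _) (abs_nonneg _)]
    gcongr
  rw [Real.norm_eq_abs, abs_mul, abs_mul, abs_of_pos (hK x)]
  have h2 := mul_le_mul_of_nonneg_left
    (mul_le_mul_of_nonneg_right h1 (abs_nonneg (v x))) (hK x).le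
  rw [← mul_assoc] at h2
  refine h2.trans_eq ?_
  rw [← abs_mul_rpow_sub_one (by linarith : q ≠ 0) (v x), ← sq_abs (v x)]
  ring

lemma fiber_bound (hq : 1 < q) (hK : ∀ x, 0 < K x) {ε C : ℝ} (hε : 0 ≤ ε) (hC : 0 ≤ C)
    (hb : ∀ t, |f t| ≤ ε * |t| + C * |t| ^ (q - 1)) (t : ℝ) (x : Ω) :
    ‖K x * prim f (t * v x)‖ ≤
      ε * t ^ 2 * (K x * v x ^ 2) + C * |t| ^ q * (K x * |v x| ^ q) := by
  rw [Real.norm_eq_abs, abs_mul, abs_of_pos (hK x)]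
  have := mul_le_mul_of_nonneg_left (prim_growth hq.le hε hC hb (t * v x)) (hK x).le
  refine this.trans_eq ?_
  rw [abs_mul, Real.mul_rpow (abs_nonneg _) (abs_nonneg _)]
  ring

variable [MeasurableSpace Ω] {μ : Measure Ω}

lemma integrable_fiber_deriv (hf : Continuous f) (hq : 1 < q) (hK : ∀ x, 0 < K x)
    (hKm : Measurable K) (hv : Measurable v)
    (hi2 : Integrable (fun x => K x * v x ^ 2) μ) (hiq : Integrable (fun x => K x * |v x| ^ q) μ)
    (h0 : f 0 = 0) (hf1 : Cf1 f) (hf2 : Cf2 f q) (t : ℝ) :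
    Integrable (fun x => K x * f (t * v x) * v x) μ := by
  obtain ⟨C, hC, hb⟩ := growth hf h0 hf1 hf2 one_pos
  refine ((hi2.const_mul |t|).add (hiq.const_mul (C * |t| ^ (q - 1)))).mono'
    ((hKm.mul (hf.measurable.comp (hv.const_mul t))).mul hv).aestronglyMeasurable
    (.of_forall fun x => fiber_deriv_bound hq hK hC hb le_rfl x)

lemma integrable_fiber (hf : Continuous f) (hq : 1 < q) (hK : ∀ x, 0 < K x)
    (hKm : Measurable K) (hv : Measurable v)
    (hi2 : Integrable (fun x => K x * v x ^ 2) μ) (hiq : Integrable (fun x => K x * |v x| ^ q) μ)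
    (h0 : f 0 = 0) (hf1 : Cf1 f) (hf2 : Cf2 f q) (t : ℝ) :
    Integrable (fun x => K x * prim f (t * v x)) μ := by
  obtain ⟨C, hC, hb⟩ := growth hf h0 hf1 hf2 one_pos
  exact ((hi2.const_mul (1 * t ^ 2)).add (hiq.const_mul (C * |t| ^ q))).mono'
    (hKm.mul ((continuous_prim hf).measurable.comp (hv.const_mul t))).aestronglyMeasurable
    (.of_forall fun x => fiber_bound hq hK zero_le_one hC hb t x)

lemma isFiber_integral (hf : Continuous f) (hq : 2 < q) (hK : ∀ x, 0 < K x)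
    (hKm : Measurable K) (hv : Measurable v)
    (hi2 : Integrable (fun x => K x * v x ^ 2) μ) (hiq : Integrable (fun x => K x * |v x| ^ q) μ)
    (hf1 : Cf1 f) (hf2 : Cf2 f q) (hf3 : Cf3 f) (hf4 : Cf4 f)
    (hv0 : ¬ v =ᵐ[μ] 0) :
    IsFiber (fun t => ∫ x, K x * prim f (t * v x) ∂μ)
      (fun t => ∫ x, K x * f (t * v x) * v x ∂μ) := by
  have h0 := apply_zero hf hf1 hf4
  have hq1 : 1 < q := by linarith
  have hint := integrable_fiber hf hq1 hK hKm hv hi2 hiq h0 hf1 hf2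
  have hint' := integrable_fiber_deriv hf hq1 hK hKm hv hi2 hiq h0 hf1 hf2
  have hsupp : 0 < μ {x | v x ≠ 0} := by
    rw [pos_iff_ne_zero]
    exact fun h => hv0 (ae_iff.2 h)
  have hpn := prim_nonneg hf hf1 hf4
  have hpos : ∀ M : ℝ, ∃ T, ∀ t, T ≤ |t| → M * t ^ 2 ≤ prim f t := by
    intro M
    obtain ⟨R, -, hR⟩ := ((Filter.HasBasis.comap _ (atTop_basis)).mem_iff).1
      (hf3 (Ici_mem_atTop M))
    refine ⟨max R 1, fun t ht => ?_⟩
    have h1 := hR (show t ∈ (fun t : ℝ => |t|) ⁻¹' Set.Ici R from (le_max_left _ _).trans ht)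
    have h2 : 0 < |t| := one_pos.trans_le ((le_max_right _ _).trans ht)
    have h3 : t ≠ 0 := abs_pos.1 h2
    simp only [Set.mem_preimage, Set.mem_Ici] at h1
    rwa [le_div_iff₀ (by positivity)] at h1
  refine ⟨by simp [prim], fun t => integral_nonneg fun x => mul_nonneg (hK x).le (hpn _),
    fun t => ?_, fun t t' ht htt => ?_, fun M => ?_, fun ε hε => ?_⟩
  · obtain ⟨C, hC, hb⟩ := growth hf h0 hf1 hf2 one_pos
    refine (hasDerivAt_integral_of_dominated_loc_of_deriv_le (μ := μ)
      (F' := fun t x => K x * f (t * v x) * v x)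
      (bound := fun x => (|t| + 1) * (K x * v x ^ 2)
        + C * (|t| + 1) ^ (q - 1) * (K x * |v x| ^ q))
      (Metric.ball_mem_nhds t one_pos)
      (.of_forall fun t => (hint t).aestronglyMeasurable) (hint t)
      (hint' t).aestronglyMeasurable (.of_forall fun x τ hτ => ?_)
      ((hi2.const_mul _).add (hiq.const_mul _)) (.of_forall fun x τ _ => ?_)).2
    · refine fiber_deriv_bound hq1 hK hC hb ?_ x
      have : |τ - t| < 1 := hτ
      have := abs_sub_abs_le_abs_sub τ t
      linarith
    · have := ((hasDerivAt_prim hf (τ * v x)).comp τ ((hasDerivAt_id τ).mul_const (v x))).const_mul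
        (K x)
      refine this.congr_deriv ?_
      ring
  · have hlt : ∀ x, v x ≠ 0 →
        K x * f (t * v x) * v x / t < K x * f (t' * v x) * v x / t' := fun x hx => by
      have := mul_lt_mul_of_pos_left (fiber_strict_mono hf4 hx ht htt) (hK x)
      simpa only [mul_assoc, mul_div_assoc] using this
    have hle : ∀ x, K x * f (t * v x) * v x / t ≤ K x * f (t' * v x) * v x / t' := fun x => by
      by_cases hx : v x = 0
      · simp [hx]
      · exact (hlt x hx).le
    rw [← integral_div, ← integral_div, ← sub_pos,
      ← integral_sub ((hint' t').div_const _) ((hint' t).div_const _),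
      integral_pos_iff_support_of_nonneg (fun x => sub_nonneg.2 (hle x))
        (((hint' t').div_const _).sub ((hint' t).div_const _))]
    refine hsupp.trans_le (measure_mono fun x hx => ?_)
    exact (sub_pos.2 (hlt x hx)).ne'
  · obtain ⟨n, hn⟩ : ∃ n : ℕ, 0 < μ {x | (1 : ℝ) / (n + 1) ≤ |v x|} := by
      by_contra! hc
      refine hsupp.ne' (measure_mono_null (fun x hx => ?_)
        (measure_iUnion_null fun n : ℕ => nonpos_iff_eq_zero.1 (hc n)))
      obtain ⟨n, hn⟩ := exists_nat_one_div_lt (abs_pos.2 hx)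
      exact Set.mem_iUnion.2 ⟨n, hn.le⟩
    set δ : ℝ := 1 / (n + 1) with hδ
    have hδ0 : 0 < δ := by positivity
    set S := {x | δ ≤ |v x|}
    have hS : MeasurableSet S := measurableSet_le measurable_const hv.abs
    set c := ∫ x in S, K x * v x ^ 2 ∂μ
    have hc : 0 < c := by
      refine (setIntegral_pos_iff_support_of_nonneg_ae
        (.of_forall fun x => mul_nonneg (hK x).le (sq_nonneg _)) hi2.integrableOn).2 ?_
      refine hn.trans_le (measure_mono fun x hx => ⟨?_, hx⟩)
      have : v x ≠ 0 := abs_pos.1 (hδ0.trans_le hx)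
      have := hK x
      simp only [Function.mem_support]
      positivity
    obtain ⟨T, hT⟩ := hpos (|M| / c)
    refine ⟨|T| / δ, fun t ht => ?_⟩
    have h1 : |M| / c * t ^ 2 * c ≤ ∫ x in S, K x * prim f (t * v x) ∂μ := by
      rw [← integral_const_mul]
      refine setIntegral_mono_on (hi2.const_mul _).integrableOn (hint t).integrableOn hS
        fun x hx => ?_
      have h2 : T ≤ |t * v x| := by
        rw [abs_mul]
        calc T ≤ |T| / δ * δ := by rw [div_mul_cancel₀ _ hδ0.ne']; exact le_abs_self T
          _ ≤ |t| * |v x| := by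
            gcongr
            · exact ht.trans (le_abs_self t)
            · exact hx
      have := mul_le_mul_of_nonneg_left (hT _ h2) (hK x).le
      refine le_of_eq_of_le ?_ this
      ring
    calc M * t ^ 2 ≤ |M| * t ^ 2 := by gcongr; exact le_abs_self M
      _ = |M| / c * t ^ 2 * c := by field_simp
      _ ≤ _ := h1
      _ ≤ _ := setIntegral_le_integral (hint t)
        (.of_forall fun x => mul_nonneg (hK x).le (hpn _))
  · set a := ∫ x, K x * v x ^ 2 ∂μ
    set b := ∫ x, K x * |v x| ^ q ∂μ
    have ha : 0 ≤ a := integral_nonneg fun x => mul_nonneg (hK x).le (sq_nonneg _)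
    have hb0 : 0 ≤ b :=
      integral_nonneg fun x => mul_nonneg (hK x).le (Real.rpow_nonneg (abs_nonneg _) _)
    set η := ε / (2 * (a + 1))
    have hη : 0 < η := by positivity
    obtain ⟨C, hC, hb⟩ := growth hf h0 hf1 hf2 hη
    have hlim : Tendsto (fun t : ℝ => t ^ (q - 2) * (C * b)) (nhds 0) (nhds 0) := by
      have := (Real.continuousAt_rpow_const 0 (q - 2) (Or.inr (by linarith))).tendsto.mul_const
        (C * b)
      rwa [Real.zero_rpow (by linarith), zero_mul] at this
    obtain ⟨δ, hδ, hlt⟩ := Metric.mem_nhds_iff.1 (hlim (gt_mem_nhds (half_pos hε)))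
    refine ⟨δ, hδ, fun t ht htδ => ?_⟩
    have h1 : t ^ (q - 2) * (C * b) < ε / 2 :=
      hlt (show t ∈ Metric.ball 0 δ by simpa [abs_of_pos ht] using htδ)
    have h2 : ∫ x, K x * prim f (t * v x) ∂μ ≤ η * t ^ 2 * a + C * |t| ^ q * b := by
      rw [← integral_const_mul, ← integral_const_mul,
        ← integral_add (hi2.const_mul _) (hiq.const_mul _)]
      exact integral_mono (hint t) ((hi2.const_mul _).add (hiq.const_mul _)) fun x =>
        (Real.le_norm_self _).trans (fiber_bound hq1 hK hη.le hC hb t x)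
    have h3 : |t| ^ q = t ^ (q - 2) * t ^ 2 := by
      rw [abs_of_pos ht, ← Real.rpow_natCast, ← Real.rpow_add ht]
      norm_num
    have h4 : η * a ≤ ε / 2 := by
      have : η * (a + 1) = ε / 2 := by simp only [η]; field_simp
      nlinarith
    rw [h3] at h2
    nlinarith [mul_le_mul_of_nonneg_right h4 (sq_nonneg t),
      mul_le_mul_of_nonneg_right h1.le (sq_nonneg t)]

end Fiber

section Sobolev

variable {N : ℕ} {α : ℝ} {u : EN N → ℝ}

/-- The Gagliardo energy density. -/
def gagDensity (N : ℕ) (α : ℝ) (u : EN N → ℝ) (x : EN N) : ENNReal :=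
  ∫⁻ y, ENNReal.ofReal ((u x - u y) ^ 2 / ‖x - y‖ ^ ((N : ℝ) + 2 * α))

lemma measurable_gagKernel (α : ℝ) (hu : Measurable u) :
    Measurable fun p : EN N × EN N =>
      ENNReal.ofReal ((u p.1 - u p.2) ^ 2 / ‖p.1 - p.2‖ ^ ((N : ℝ) + 2 * α)) := by
  fun_prop

lemma measurable_gagDensity (α : ℝ) (hu : Measurable u) : Measurable (gagDensity N α u) :=
  (measurable_gagKernel α hu).lintegral_prod_right'

lemma lintegral_gagDensity (α : ℝ) (hu : Measurable u) :
    ∫⁻ x, gagDensity N α u x = gagSq N α u := by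
  unfold gagDensity gagSq
  rw [Measure.volume_eq_prod, lintegral_prod _ (measurable_gagKernel α hu).aemeasurable]

lemma sq_sub_average_mul_le {Ω : Type*} [MeasurableSpace Ω] {μ : Measure Ω} {v : Ω → ℝ} {T : Set Ω}
    (hv : Measurable v) (h0 : μ T ≠ 0) (hT : μ T ≠ ⊤)
    (hi : IntegrableOn (fun x => v x ^ 2) T μ) (a : ℝ) :
    ENNReal.ofReal ((a - ⨍ x in T, v x ∂μ) ^ 2) * μ T ≤
      ∫⁻ x in T, ENNReal.ofReal ((a - v x) ^ 2) ∂μ := by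
  have : IsFiniteMeasure (μ.restrict T) := ⟨by simpa using hT.lt_top⟩
  have hm : MemLp v 2 (μ.restrict T) := (memLp_two_iff_integrable_sq hv.aestronglyMeasurable).2 hi
  have hi1 : IntegrableOn v T μ := hm.integrable one_le_two
  have hi2 : IntegrableOn (fun x => (a - v x) ^ 2) T μ :=
    ((memLp_const a).sub hm).integrable_sq
  have hconv : ConvexOn ℝ Set.univ fun y : ℝ => (a - y) ^ 2 := by
    have h := (even_two.convexOn_pow (𝕜 := ℝ)).comp_affineMap
      (AffineMap.const ℝ ℝ a - (AffineMap.id ℝ ℝ))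
    simpa [Function.comp_def] using h
  have hJ := hconv.map_set_average_le (by fun_prop) isClosed_univ h0 hT (by simp) hi1 hi2
  rw [setAverage_eq μ (fun x => (a - v x) ^ 2), smul_eq_mul] at hJ
  have hpos : 0 < μ.real T := ENNReal.toReal_pos h0 hT
  rw [← ofReal_integral_eq_lintegral_ofReal hi2 (.of_forall fun x => sq_nonneg _),
    ← ENNReal.ofReal_toReal hT, ← ENNReal.ofReal_mul (sq_nonneg _)]
  refine ENNReal.ofReal_le_ofReal ?_
  rw [inv_mul_eq_div, le_div_iff₀ hpos] at hJ
  exact hJ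

lemma sq_sub_le_mul_gagKernel (hα : 0 < α) {ρ : ℝ} {y z : EN N} (h : ‖y - z‖ ≤ ρ) :
    ENNReal.ofReal ((u y - u z) ^ 2) ≤ ENNReal.ofReal (ρ ^ ((N : ℝ) + 2 * α)) *
      ENNReal.ofReal ((u y - u z) ^ 2 / ‖y - z‖ ^ ((N : ℝ) + 2 * α)) := by
  have hρ : 0 ≤ ρ := (norm_nonneg _).trans h
  rw [← ENNReal.ofReal_mul (Real.rpow_nonneg hρ _)]
  refine ENNReal.ofReal_le_ofReal ?_
  rcases eq_or_ne y z with rfl | hyz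
  · simp
  have h1 : 0 < ‖y - z‖ := norm_pos_iff.2 (sub_ne_zero.2 hyz)
  have h2 : 0 < ‖y - z‖ ^ ((N : ℝ) + 2 * α) := Real.rpow_pos_of_pos h1 _
  rw [← mul_div_assoc, le_div_iff₀ h2, mul_comm]
  gcongr

/-- The average of `u` over a ball. -/
def ballAvg (u : EN N → ℝ) (x : EN N) (r : ℝ) : ℝ := ⨍ y in Metric.ball x r, u y

lemma volume_ball_eq (x : EN N) {r : ℝ} (hr : 0 < r) :
    volume (Metric.ball x r) =
      ENNReal.ofReal (r ^ (N : ℝ) * volume.real (Metric.ball (0 : EN N) 1)) := by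
  rw [Measure.addHaar_ball_of_pos _ _ hr, finrank_euclideanSpace_fin, Real.rpow_natCast,
    ENNReal.ofReal_mul (by positivity), ofReal_measureReal measure_ball_lt_top.ne]

lemma unitBall_pos : 0 < volume.real (Metric.ball (0 : EN N) 1) :=
  ENNReal.toReal_pos (Metric.measure_ball_pos _ _ one_pos).ne' measure_ball_lt_top.ne

variable (hα : 0 < α) (hu : Measurable u)
  (hloc : ∀ x r, IntegrableOn (fun y => u y ^ 2) (Metric.ball x r))
include hα hu hloc

lemma sq_sub_ballAvg_le {x : EN N} (hx : gagDensity N α u x ≠ ⊤) {r : ℝ} (hr : 0 < r) :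
    (u x - ballAvg u x r) ^ 2 ≤
      r ^ (2 * α) * (gagDensity N α u x).toReal / volume.real (Metric.ball (0 : EN N) 1) := by
  have hω := unitBall_pos (N := N)
  set ω := volume.real (Metric.ball (0 : EN N) 1)
  have h1 := sq_sub_average_mul_le hu (Metric.measure_ball_pos volume x hr).ne'
    measure_ball_lt_top.ne (hloc x r) (u x)
  have h2 : ∫⁻ y in Metric.ball x r, ENNReal.ofReal ((u x - u y) ^ 2) ≤
      ENNReal.ofReal (r ^ ((N : ℝ) + 2 * α)) * gagDensity N α u x := by
    unfold gagDensity
    rw [← lintegral_const_mul _ (by fun_prop)]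
    refine le_trans (setLIntegral_mono (by fun_prop) fun y hy => ?_) (setLIntegral_le_lintegral _ _)
    refine sq_sub_le_mul_gagKernel hα ?_
    rw [← dist_eq_norm, dist_comm]
    exact (Metric.mem_ball.1 hy).le
  have h3 := h1.trans h2
  rw [volume_ball_eq x hr, ← ENNReal.ofReal_toReal hx, ← ENNReal.ofReal_mul (sq_nonneg _),
    ← ENNReal.ofReal_mul (by positivity), ENNReal.ofReal_le_ofReal_iff (by positivity),
    Real.rpow_add hr] at h3
  rw [le_div_iff₀ hω]
  have hrN : 0 < r ^ (N : ℝ) := Real.rpow_pos_of_pos hr _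
  refine le_of_mul_le_mul_left (le_of_eq_of_le ?_ (h3.trans_eq ?_)) hrN
  · unfold ballAvg; ring
  · ring

lemma sq_ballAvg_sub_ballAvg_le (hE : gagSq N α u ≠ ⊤) (x x' : EN N) {r r' : ℝ}
    (hr : 0 < r) (hr' : 0 < r') :
    (ballAvg u x r - ballAvg u x' r') ^ 2 * (r ^ (N : ℝ) * r' ^ (N : ℝ)) ≤
      (‖x - x'‖ + r + r') ^ ((N : ℝ) + 2 * α) *
        ((gagSq N α u).toReal / volume.real (Metric.ball (0 : EN N) 1) ^ 2) := by
  have hω := unitBall_pos (N := N)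
  set ω := volume.real (Metric.ball (0 : EN N) 1)
  set ρ := ‖x - x'‖ + r + r'
  have h1 := sq_sub_average_mul_le hu (Metric.measure_ball_pos volume x hr).ne'
    measure_ball_lt_top.ne (hloc x r) (ballAvg u x' r')
  have h2 : (∫⁻ y in Metric.ball x r, ENNReal.ofReal ((ballAvg u x' r' - u y) ^ 2)) *
      volume (Metric.ball x' r') ≤ ENNReal.ofReal (ρ ^ ((N : ℝ) + 2 * α)) * gagSq N α u := by
    rw [← lintegral_mul_const _ (by fun_prop), ← lintegral_gagDensity α hu,
      ← lintegral_const_mul _ (measurable_gagDensity α hu)]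
    refine le_trans (setLIntegral_mono ((measurable_gagDensity α hu).const_mul _) fun y hy => ?_)
      (setLIntegral_le_lintegral _ _)
    have h3 := sq_sub_average_mul_le hu (Metric.measure_ball_pos volume x' hr').ne'
      measure_ball_lt_top.ne (hloc x' r') (u y)
    rw [sub_sq_comm]
    refine h3.trans ?_
    unfold gagDensity
    rw [← lintegral_const_mul _ (by fun_prop)]
    refine le_trans (setLIntegral_mono (by fun_prop) fun z hz => ?_) (setLIntegral_le_lintegral _ _)
    refine sq_sub_le_mul_gagKernel hα ?_
    have hy' := (Metric.mem_ball.1 hy).le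
    have hz' := (Metric.mem_ball'.1 hz).le
    have := dist_triangle4 y x x' z
    rw [← dist_eq_norm]
    simp only [ρ, ← dist_eq_norm]
    linarith
  have h3 := (mul_le_mul_left h1 (volume (Metric.ball x' r'))).trans h2
  rw [volume_ball_eq x hr, volume_ball_eq x' hr', ← ENNReal.ofReal_toReal hE,
    ← ENNReal.ofReal_mul (sq_nonneg _), ← ENNReal.ofReal_mul (by positivity),
    ← ENNReal.ofReal_mul (by positivity), ENNReal.ofReal_le_ofReal_iff (by positivity),
    sub_sq_comm] at h3
  rw [← mul_div_assoc, le_div_iff₀ (by positivity)]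
  refine le_of_eq_of_le ?_ h3
  unfold ballAvg; ring

/-- The averages over balls of radius `r` converge, at rate `r^{-(N-2α)/2}` as `r → ∞`, to a
constant that does not depend on the centre. -/
lemma exists_ballAvg_limit (hN : 2 * α < N) (hE : gagSq N α u ≠ ⊤) :
    ∃ c C : ℝ, 0 < C ∧ ∀ x r, 0 < r →
      |ballAvg u x r - c| ≤ C * r ^ (-(((N : ℝ) - 2 * α) / 2)) := by
  set β := ((N : ℝ) - 2 * α) / 2 with hβ
  have hβ0 : 0 < β := by simp only [hβ]; linarith
  have key := sq_ballAvg_sub_ballAvg_le hα hu hloc hE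
  set E := (gagSq N α u).toReal / volume.real (Metric.ball (0 : EN N) 1) ^ 2
  have hE0 : 0 ≤ E := by positivity
  set C₀ := √(3 ^ ((N : ℝ) + 2 * α) * E / 2 ^ (N : ℝ))
  have hrpow : ∀ R : ℝ, 0 < R →
      R ^ ((N : ℝ) + 2 * α) = (R ^ (-β)) ^ 2 * (R ^ (N : ℝ) * R ^ (N : ℝ)) := fun R hR => by
    rw [← Real.rpow_natCast (R ^ (-β)), ← Real.rpow_mul hR.le, ← Real.rpow_add hR,
      ← Real.rpow_add hR]
    congr 1
    simp only [hβ]; push_cast; ring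
  have hdouble : ∀ x R, 0 < R → |ballAvg u x R - ballAvg u x (2 * R)| ≤ C₀ * R ^ (-β) := by
    intro x R hR
    have hRN : 0 < R ^ (N : ℝ) := Real.rpow_pos_of_pos hR _
    have h := key x x hR (show 0 < 2 * R by positivity)
    rw [sub_self, norm_zero, show 0 + R + 2 * R = 3 * R by ring,
      Real.mul_rpow (by norm_num) hR.le, Real.mul_rpow (by norm_num) hR.le, hrpow R hR] at h
    refine abs_le_of_sq_le_sq ?_ (by positivity)
    rw [mul_pow, Real.sq_sqrt (by positivity), div_mul_eq_mul_div, le_div_iff₀ (by positivity)]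
    refine le_of_mul_le_mul_right ?_ (mul_pos hRN hRN)
    refine le_of_eq_of_le ?_ (h.trans_eq ?_) <;> ring
  set η : ℝ := 2 ^ (-β) with hη
  have hη1 : η < 1 := Real.rpow_lt_one_of_one_lt_of_neg one_lt_two (by linarith)
  have hη0 : 0 < η := by positivity
  have hgeo : ∀ x r, 0 < r → ∀ k : ℕ,
      dist (ballAvg u x (2 ^ k * r)) (ballAvg u x (2 ^ (k + 1) * r)) ≤ C₀ * r ^ (-β) * η ^ k := by
    intro x r hr k
    have h := hdouble x (2 ^ k * r) (by positivity)
    rw [Real.mul_rpow (by positivity) hr.le, ← Real.rpow_natCast, ← Real.rpow_mul zero_le_two,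
      mul_comm (k : ℝ), Real.rpow_mul zero_le_two, Real.rpow_natCast, Real.rpow_natCast] at h
    rw [Real.dist_eq, pow_succ', mul_assoc 2]
    refine h.trans_eq ?_
    ring
  have hlim : ∀ x r, 0 < r →
      ∃ c, Tendsto (fun k : ℕ => ballAvg u x (2 ^ k * r)) atTop (nhds c) := fun x r hr =>
    cauchySeq_tendsto_of_complete (cauchySeq_of_le_geometric _ _ hη1 (hgeo x r hr))
  obtain ⟨c, hc⟩ := hlim 0 1 one_pos
  have hcompare : ∀ x r, 0 < r →
      Tendsto (fun k : ℕ => ballAvg u x (2 ^ k * r) - ballAvg u 0 (2 ^ k * 1)) atTop (nhds 0) := by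
    intro x r hr
    have hsq : Tendsto (fun k : ℕ =>
        (ballAvg u x (2 ^ k * r) - ballAvg u 0 (2 ^ k * 1)) ^ 2) atTop (nhds 0) := by
      refine squeeze_zero (g := fun k : ℕ =>
        (‖x‖ + r + 1) ^ ((N : ℝ) + 2 * α) * E / r ^ (N : ℝ) * (η ^ 2) ^ k)
        (fun k => sq_nonneg _) (fun k => ?_) ?_
      · set P : ℝ := 2 ^ k
        have hP : 1 ≤ P := one_le_pow₀ one_le_two
        have hP0 : 0 < P := by positivity
        have hPN : 0 < P ^ (N : ℝ) := Real.rpow_pos_of_pos hP0 _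
        have hrN : 0 < r ^ (N : ℝ) := Real.rpow_pos_of_pos hr _
        have h := key x 0 (show 0 < P * r by positivity) (show 0 < P * 1 by positivity)
        have h' : (‖x - 0‖ + P * r + P * 1) ^ ((N : ℝ) + 2 * α) ≤
            (P * (‖x‖ + r + 1)) ^ ((N : ℝ) + 2 * α) := by
          refine Real.rpow_le_rpow (by positivity) ?_ (by positivity)
          rw [sub_zero]
          nlinarith [norm_nonneg x]
        have h2 := h.trans (mul_le_mul_of_nonneg_right h' hE0)
        have hPη : P ^ (-β) = η ^ k := by
          simp only [P, hη]
          rw [← Real.rpow_natCast, ← Real.rpow_natCast, ← Real.rpow_mul zero_le_two,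
            ← Real.rpow_mul zero_le_two, mul_comm]
        rw [Real.mul_rpow hP0.le (show 0 ≤ ‖x‖ + r + 1 by positivity), Real.mul_rpow hP0.le hr.le, mul_one,
          hrpow P hP0, hPη] at h2
        rw [div_mul_eq_mul_div, le_div_iff₀ hrN, mul_one]
        refine le_of_mul_le_mul_right ?_ (mul_pos hPN hPN)
        refine le_of_eq_of_le ?_ (h2.trans_eq ?_) <;> ring
      · have := (tendsto_pow_atTop_nhds_zero_of_lt_one (sq_nonneg η)
          (by nlinarith : η ^ 2 < 1)).const_mul
          ((‖x‖ + r + 1) ^ ((N : ℝ) + 2 * α) * E / r ^ (N : ℝ))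
        rwa [mul_zero] at this
    have := hsq.sqrt
    simp only [Real.sqrt_sq_eq_abs, Real.sqrt_zero] at this
    exact (tendsto_zero_iff_abs_tendsto_zero _).2 this
  refine ⟨c, C₀ / (1 - η) + 1, add_pos_of_nonneg_of_pos
    (div_nonneg (Real.sqrt_nonneg _) (by linarith)) one_pos, fun x r hr => ?_⟩
  have hcx : Tendsto (fun k : ℕ => ballAvg u x (2 ^ k * r)) atTop (nhds c) := by
    simpa using (hcompare x r hr).add hc
  have h := dist_le_of_le_geometric_of_tendsto₀ _ _ hη1 (hgeo x r hr) hcx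
  rw [pow_zero, one_mul, Real.dist_eq] at h
  refine h.trans ?_
  have : 0 < r ^ (-β) := Real.rpow_pos_of_pos hr _
  rw [add_mul, mul_div_right_comm]
  linarith

/-- Fractional Sobolev inequality, up to an additive constant `c`: pointwise form. -/
lemma exists_abs_sub_rpow_le (hN : 2 * α < N) (hE : gagSq N α u ≠ ⊤) :
    ∃ c D : ℝ, 0 < D ∧ ∀ x, gagDensity N α u x ≠ ⊤ →
      |u x - c| ^ critExp N α ≤ D * (gagDensity N α u x).toReal := by
  obtain ⟨c, C, hC, hcC⟩ := exists_ballAvg_limit hα hu hloc hN hE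
  have hω := unitBall_pos (N := N)
  set ω := volume.real (Metric.ball (0 : EN N) 1)
  have hN0 : (0 : ℝ) < N := by linarith
  have hNα : (0 : ℝ) < N - 2 * α := by linarith
  have hq : 0 < critExp N α := by unfold critExp; positivity
  set B := 1 / √ω + C
  have hB : 0 < B := by positivity
  refine ⟨c, B ^ critExp N α, by positivity, fun x hx => ?_⟩
  set e := (gagDensity N α u x).toReal
  have he : 0 ≤ e := ENNReal.toReal_nonneg
  rw [mul_comm, ← div_le_iff₀ (by positivity)]
  refine le_of_forall_gt_imp_ge_of_dense fun e' he' => ?_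
  have he'0 : 0 < e' := he.trans_lt he'
  rw [div_le_iff₀ (by positivity)]
  set r := e' ^ (-(1 / (N : ℝ)))
  have hr : 0 < r := Real.rpow_pos_of_pos he'0 _
  have h1 : |u x - ballAvg u x r| ≤ 1 / √ω * e' ^ (1 / critExp N α) := by
    refine abs_le_of_sq_le_sq ?_ (by positivity)
    rw [mul_pow, div_pow, one_pow, Real.sq_sqrt hω.le, ← Real.rpow_natCast (e' ^ _),
      ← Real.rpow_mul he'0.le, one_div_mul_eq_div]
    refine (sq_sub_ballAvg_le hα hu hloc hx hr).trans ?_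
    gcongr
    calc r ^ (2 * α) * e ≤ r ^ (2 * α) * e' ^ (1 : ℝ) := by rw [Real.rpow_one]; gcongr
      _ = _ := by
        simp only [r]
        rw [← Real.rpow_mul he'0.le, ← Real.rpow_add he'0]
        congr 1
        unfold critExp
        field_simp
        push_cast
        ring
  have h2 : |ballAvg u x r - c| ≤ C * e' ^ (1 / critExp N α) := by
    refine (hcC x r hr).trans_eq ?_
    simp only [r]
    rw [← Real.rpow_mul he'0.le]
    congr 2
    unfold critExp
    field_simp
  have h3 : |u x - c| ≤ B * e' ^ (1 / critExp N α) := by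
    have := abs_sub_le (u x) (ballAvg u x r) c
    simp only [B]
    linarith
  calc |u x - c| ^ critExp N α ≤ (B * e' ^ (1 / critExp N α)) ^ critExp N α := by gcongr
    _ = e' * B ^ critExp N α := by
      rw [Real.mul_rpow hB.le (by positivity), ← Real.rpow_mul he'0.le,
        one_div_mul_cancel hq.ne', Real.rpow_one, mul_comm]

/-- Fractional Sobolev embedding, up to an additive constant. -/
lemma exists_integrable_abs_sub_rpow (hN : 2 * α < N) (hE : gagSq N α u ≠ ⊤) :
    ∃ c : ℝ, Integrable fun x => |u x - c| ^ critExp N α := by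
  obtain ⟨c, D, hD, h⟩ := exists_abs_sub_rpow_le hα hu hloc hN hE
  have hm := measurable_gagDensity α hu
  have hfin : ∫⁻ x, gagDensity N α u x ≠ ⊤ := by rwa [lintegral_gagDensity α hu]
  refine ⟨c, ((integrable_toReal_of_lintegral_ne_top hm.aemeasurable hfin).const_mul D).mono'
    ((hu.sub_const c).abs.pow_const _).aestronglyMeasurable ?_⟩
  filter_upwards [ae_lt_top hm hfin] with x hx
  rw [Real.norm_of_nonneg (by positivity)]
  exact h x hx.ne

end Sobolev

section Space

variable {N : ℕ} {α : ℝ} {V K : EN N → ℝ} {f : ℝ → ℝ} {u : EN N → ℝ}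

/-- The integrand of the Gagliardo bilinear form. -/
def gagForm (α : ℝ) (u φ : EN N → ℝ) (p : EN N × EN N) : ℝ :=
  (u p.1 - u p.2) * (φ p.1 - φ p.2) / ‖p.1 - p.2‖ ^ ((N : ℝ) + 2 * α)

lemma gagForm_self (α : ℝ) (u : EN N → ℝ) (p : EN N × EN N) :
    gagForm α u u p = (u p.1 - u p.2) ^ 2 / ‖p.1 - p.2‖ ^ ((N : ℝ) + 2 * α) := by
  rw [gagForm, ← sq]

lemma gagForm_self_nonneg (α : ℝ) (u : EN N → ℝ) (p : EN N × EN N) : 0 ≤ gagForm α u u p := by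
  rw [gagForm_self]; positivity

lemma measurable_gagForm (α : ℝ) {u φ : EN N → ℝ} (hu : Measurable u) (hφ : Measurable φ) :
    Measurable (gagForm α u φ) := by
  unfold gagForm
  fun_prop

lemma gagSq_eq (α : ℝ) (u : EN N → ℝ) :
    gagSq N α u = ∫⁻ p, ENNReal.ofReal (gagForm α u u p) := by
  simp only [gagSq, gagForm_self]

lemma memX_iff (hV : Measurable V) (hV0 : ∀ x, 0 < V x) :
    memX α V u ↔ Measurable u ∧ Integrable (gagForm α u u) ∧
      Integrable fun x => V x * u x ^ 2 := by
  refine and_congr_right fun hu => ?_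
  rw [normSq, ENNReal.add_lt_top, gagSq_eq,
    ← hasFiniteIntegral_iff_ofReal (.of_forall (gagForm_self_nonneg α u)),
    ← hasFiniteIntegral_iff_ofReal
      (.of_forall fun x => mul_nonneg (hV0 x).le (sq_nonneg (u x)))]
  exact and_congr ⟨fun h => ⟨(measurable_gagForm α hu hu).aestronglyMeasurable, h⟩, fun h => h.2⟩
    ⟨fun h => ⟨(hV.mul (hu.pow_const 2)).aestronglyMeasurable, h⟩, fun h => h.2⟩

lemma normSq_toReal (hV0 : ∀ x, 0 < V x) (hg : Integrable (gagForm α u u))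
    (hi : Integrable fun x => V x * u x ^ 2) :
    (normSq α V u).toReal = (∫ p, gagForm α u u p) + ∫ x, V x * u x ^ 2 := by
  have h1 := (hasFiniteIntegral_iff_ofReal (.of_forall (gagForm_self_nonneg α u))).1 hg.2
  have h2 := (hasFiniteIntegral_iff_ofReal
      (.of_forall fun x => mul_nonneg (hV0 x).le (sq_nonneg (u x)))).1 hi.2
  rw [normSq, gagSq_eq, ENNReal.toReal_add h1.ne h2.ne,
    integral_eq_lintegral_of_nonneg_ae (.of_forall (gagForm_self_nonneg α u)) hg.1,
    integral_eq_lintegral_of_nonneg_ae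
      (.of_forall fun x => mul_nonneg (hV0 x).le (sq_nonneg (u x))) hi.1]

lemma integrable_gagForm {u φ : EN N → ℝ} (hu : Measurable u) (hφ : Measurable φ)
    (hgu : Integrable (gagForm α u u)) (hgφ : Integrable (gagForm α φ φ)) :
    Integrable (gagForm α u φ) := by
  refine (hgu.add hgφ).mono' (measurable_gagForm α hu hφ).aestronglyMeasurable
    (.of_forall fun p => ?_)
  rw [Pi.add_apply, gagForm_self, gagForm_self, ← add_div, gagForm, norm_div, Real.norm_eq_abs,
    Real.norm_of_nonneg (by positivity), abs_mul]
  gcongr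
  nlinarith [sq_nonneg (|u p.1 - u p.2| - |φ p.1 - φ p.2|), sq_abs (u p.1 - u p.2),
    sq_abs (φ p.1 - φ p.2), sq_nonneg (u p.1 - u p.2), sq_nonneg (φ p.1 - φ p.2)]

/-- `X` is stable under normal contractions. -/
lemma memX_of_contraction (hV : Measurable V) (hV0 : ∀ x, 0 < V x) (hu : memX α V u)
    {θ : ℝ → ℝ} (hθ : ∀ a b, |θ a - θ b| ≤ |a - b|) (hθ0 : θ 0 = 0) :
    memX α V fun x => θ (u x) := by
  rw [memX_iff hV hV0] at hu ⊢
  obtain ⟨hm, hg, hi⟩ := hu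
  have hθm : Measurable θ := by
    have : LipschitzWith 1 θ := LipschitzWith.of_dist_le_mul fun a b => by
      simpa [Real.dist_eq] using hθ a b
    exact this.continuous.measurable
  have hm' := hθm.comp hm
  refine ⟨hm', hg.mono' (measurable_gagForm α hm' hm').aestronglyMeasurable
    (.of_forall fun p => ?_), hi.mono' (hV.mul (hm'.pow_const 2)).aestronglyMeasurable
    (.of_forall fun x => ?_)⟩
  · rw [Real.norm_of_nonneg (gagForm_self_nonneg _ _ _), gagForm_self, gagForm_self]
    exact div_le_div_of_nonneg_right (sq_le_sq.2 (hθ _ _)) (by positivity)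
  · have h0 := hV0 x
    rw [Real.norm_of_nonneg (by positivity)]
    refine mul_le_mul_of_nonneg_left (sq_le_sq.2 ?_) h0.le
    simpa [hθ0] using hθ (u x) 0

lemma integrableOn_sq (hV : Continuous V) (hV0 : ∀ x, 0 < V x) (hu : Measurable u)
    (hi : Integrable fun x => V x * u x ^ 2) (x : EN N) (r : ℝ) :
    IntegrableOn (fun y => u y ^ 2) (Metric.ball x r) := by
  rcases le_or_gt r 0 with hr | hr
  · simp [Metric.ball_eq_empty.2 hr]
  obtain ⟨z, -, hz⟩ := (isCompact_closedBall x r).exists_isMinOn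
    ⟨x, Metric.mem_closedBall_self hr.le⟩ hV.continuousOn
  refine (hi.const_mul (V z)⁻¹).integrableOn.mono' (hu.pow_const 2).aestronglyMeasurable ?_
  filter_upwards [ae_restrict_mem Metric.isOpen_ball.measurableSet] with y hy
  rw [Real.norm_of_nonneg (sq_nonneg _), inv_mul_eq_div, le_div_iff₀ (hV0 z), mul_comm]
  exact mul_le_mul_of_nonneg_right (hz (Metric.ball_subset_closedBall hy)) (sq_nonneg _)

lemma two_lt_critExp (hα : 0 < α) (hN : 2 * α < N) : 2 < critExp N α := by
  unfold critExp
  rw [lt_div_iff₀ (by linarith)]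
  linarith

lemma abs_rpow_le_of_sub {q : ℝ} (hq : 0 ≤ q) (a c : ℝ) :
    |a| ^ q ≤ 2 ^ q * |a - c| ^ q + 2 ^ q * |c| ^ q := by
  have h1 : |a| ≤ 2 * max |a - c| |c| := by
    have := abs_add_le (a - c) c
    rw [sub_add_cancel] at this
    linarith [le_max_left |a - c| |c|, le_max_right |a - c| |c|]
  have h2 : |a| ^ q ≤ 2 ^ q * max |a - c| |c| ^ q := by
    rw [← Real.mul_rpow zero_le_two (by positivity)]
    gcongr
  refine h2.trans ?_
  rcases max_cases |a - c| |c| with h | h <;> rw [h.1]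
  · exact le_add_of_nonneg_right (by positivity)
  · exact le_add_of_nonneg_left (by positivity)

lemma integrable_mul_sq (hV0 : ∀ x, 0 < V x) (hK0 : ∀ x, 0 < K x) (hKm : Measurable K)
    (h3 : H3 V K) (hm : Measurable u) (hi : Integrable fun x => V x * u x ^ 2) :
    Integrable fun x => K x * u x ^ 2 := by
  obtain ⟨C, hC⟩ := h3
  refine (hi.const_mul C).mono' (hKm.mul (hm.pow_const 2)).aestronglyMeasurable
    (.of_forall fun x => ?_)
  have := (div_le_iff₀ (hV0 x)).1 (hC x)
  have h0 := hK0 x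
  rw [Real.norm_of_nonneg (by positivity), ← mul_assoc]
  gcongr

/-- Embedding of `X` into the `K`-weighted `L^{2*_α}`. -/
lemma integrable_mul_critExp (hα : 0 < α) (hN : 2 * α < N) (hV : Continuous V)
    (hK : Continuous K) (h1 : H1 V K) (h3 : H3 V K) (hu : memX α V u) :
    Integrable fun x => K x * |u x| ^ critExp N α := by
  obtain ⟨hV0, hK0, M, hM⟩ := h1
  have hM0 : 0 < M := (hK0 0).trans_le (hM 0)
  have hE : gagSq N α u ≠ ⊤ := (ENNReal.add_lt_top.1 hu.2).1.ne
  obtain ⟨hm, hg, hi⟩ := (memX_iff hV.measurable hV0).1 hu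
  obtain ⟨c, hc⟩ := exists_integrable_abs_sub_rpow hα hm
    (integrableOn_sq hV hV0 hm hi) hN hE
  have hq := two_lt_critExp hα hN
  set q := critExp N α
  have hiK := integrable_mul_sq hV0 hK0 hK.measurable h3 hm hi
  have hKc : Integrable fun x => K x * |c| ^ q := by
    rcases eq_or_ne c 0 with rfl | hc0
    · simp [Real.zero_rpow (by linarith : q ≠ 0)]
    have hcp := abs_pos.2 hc0
    refine Integrable.mul_const ?_ _
    refine ((hc.const_mul (M / (|c| / 2) ^ q)).add (hiK.const_mul (1 / (|c| / 2) ^ 2))).mono'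
      hK.aestronglyMeasurable (.of_forall fun x => ?_)
    have h0 := hK0 x
    rw [Real.norm_of_nonneg h0.le, Pi.add_apply]
    rcases le_total (|c| / 2) |u x - c| with h | h
    · refine le_add_of_le_of_nonneg ((hM x).trans ?_) (by positivity)
      rw [div_mul_eq_mul_div, le_div_iff₀ (by positivity)]
      gcongr
    · refine le_add_of_nonneg_of_le (by positivity) ?_
      have h2 : |c| / 2 ≤ |u x| := by
        have := abs_sub_abs_le_abs_sub c (u x)
        rw [abs_sub_comm] at this
        linarith
      rw [one_div_mul_eq_div, le_div_iff₀ (by positivity), ← sq_abs (u x)]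
      gcongr
  refine ((hc.const_mul (2 ^ q * M)).add (hKc.const_mul (2 ^ q))).mono'
    (hK.measurable.mul (hm.abs.pow_const q)).aestronglyMeasurable (.of_forall fun x => ?_)
  have h0 := hK0 x
  rw [Real.norm_of_nonneg (by positivity), Pi.add_apply]
  calc K x * |u x| ^ q ≤ K x * (2 ^ q * |u x - c| ^ q + 2 ^ q * |c| ^ q) := by
        gcongr
        exact abs_rpow_le_of_sub (by linarith) _ _
    _ = 2 ^ q * K x * |u x - c| ^ q + 2 ^ q * (K x * |c| ^ q) := by ring
    _ ≤ 2 ^ q * M * |u x - c| ^ q + 2 ^ q * (K x * |c| ^ q) := by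
        gcongr
        exact hM x

end Space

section Splitting

variable {N : ℕ} {α : ℝ} {V K : EN N → ℝ} {f : ℝ → ℝ} {p m : EN N → ℝ}

lemma gagForm_comb_left (φ : EN N → ℝ) (t s : ℝ) (z : EN N × EN N) :
    gagForm α (fun x => t * p x + s * m x) φ z = t * gagForm α p φ z + s * gagForm α m φ z := by
  simp only [gagForm]; ring

lemma gagForm_comm (u φ : EN N → ℝ) (z : EN N × EN N) : gagForm α u φ z = gagForm α φ u z := by
  simp only [gagForm]; ring

lemma gagForm_comb_self (t s : ℝ) (z : EN N × EN N) :
    gagForm α (fun x => t * p x + s * m x) (fun x => t * p x + s * m x) z =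
      t ^ 2 * gagForm α p p z + s ^ 2 * gagForm α m m z + 2 * (t * s) * gagForm α p m z := by
  simp only [gagForm]; ring

lemma Jd_const_mul (w φ : EN N → ℝ) (t : ℝ) :
    Jd α V K f w (fun x => t * φ x) = t * Jd α V K f w φ := by
  simp only [Jd, mul_sub, mul_add, ← integral_const_mul]
  refine congrArg₂ _ (congrArg₂ _ ?_ ?_) ?_ <;>
    exact integral_congr_ae (.of_forall fun z => by ring)

lemma integral_gagForm_comb_self (hp : Measurable p) (hm : Measurable m)
    (hgp : Integrable (gagForm α p p)) (hgm : Integrable (gagForm α m m)) (t s : ℝ) :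
    ∫ z, gagForm α (fun x => t * p x + s * m x) (fun x => t * p x + s * m x) z =
      t ^ 2 * (∫ z, gagForm α p p z) + s ^ 2 * (∫ z, gagForm α m m z)
        + 2 * (t * s) * ∫ z, gagForm α p m z := by
  have h1 := hgp.const_mul (t ^ 2)
  have h2 := hgm.const_mul (s ^ 2)
  have h3 : Integrable fun z => t ^ 2 * gagForm α p p z + s ^ 2 * gagForm α m m z := h1.add h2
  simp only [gagForm_comb_self]
  rw [integral_add h3 ((integrable_gagForm hp hm hgp hgm).const_mul _),
    integral_add h1 h2, integral_const_mul, integral_const_mul, integral_const_mul]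

variable (hdisj : ∀ x, p x = 0 ∨ m x = 0)
include hdisj

lemma gagForm_nonneg_of_disjoint (hp0 : ∀ x, 0 ≤ p x) (hm0 : ∀ x, m x ≤ 0) (z : EN N × EN N) :
    0 ≤ gagForm α p m z := by
  refine div_nonneg ?_ (by positivity)
  have h1 : p z.1 * m z.1 = 0 := by rcases hdisj z.1 with h | h <;> simp [h]
  have h2 : p z.2 * m z.2 = 0 := by rcases hdisj z.2 with h | h <;> simp [h]
  nlinarith [mul_nonneg (hp0 z.1) (neg_nonneg.2 (hm0 z.2)),
    mul_nonneg (hp0 z.2) (neg_nonneg.2 (hm0 z.1))]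

lemma mul_sq_comb (t s : ℝ) (x : EN N) :
    V x * (t * p x + s * m x) ^ 2 = t ^ 2 * (V x * p x ^ 2) + s ^ 2 * (V x * m x ^ 2) := by
  rcases hdisj x with h | h <;> rw [h] <;> ring

lemma memX_comb (hV : Measurable V) (hV0 : ∀ x, 0 < V x) (hp : memX α V p) (hm : memX α V m)
    (t s : ℝ) : memX α V fun x => t * p x + s * m x := by
  rw [memX_iff hV hV0] at hp hm ⊢
  refine ⟨(hp.1.const_mul t).add (hm.1.const_mul s), ?_, ?_⟩
  · simp only [funext (gagForm_comb_self (α := α) (p := p) (m := m) t s)]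
    exact ((hp.2.1.const_mul _).add (hm.2.1.const_mul _)).add
      ((integrable_gagForm hp.1 hm.1 hp.2.1 hm.2.1).const_mul _)
  · simp only [mul_sq_comb hdisj]
    exact (hp.2.2.const_mul _).add (hm.2.2.const_mul _)

lemma Jfun_comb (hV : Measurable V) (hV0 : ∀ x, 0 < V x) (hp : memX α V p) (hm : memX α V m)
    (t s : ℝ) (hip : Integrable fun x => K x * prim f (t * p x))
    (him : Integrable fun x => K x * prim f (s * m x)) :
    Jfun α V K f (fun x => t * p x + s * m x) =
      fiberEnergy ((normSq α V p).toReal) ((normSq α V m).toReal) (∫ z, gagForm α p m z)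
        (fun t => ∫ x, K x * prim f (t * p x)) (fun s => ∫ x, K x * prim f (s * m x)) t s := by
  have hw := memX_comb hdisj hV hV0 hp hm t s
  rw [memX_iff hV hV0] at hp hm hw
  have hK : ∫ x, K x * prim f (t * p x + s * m x) =
      (∫ x, K x * prim f (t * p x)) + ∫ x, K x * prim f (s * m x) := by
    rw [← integral_add hip him]
    congr 1
    ext x
    rcases hdisj x with h | h <;> simp [h, prim]
  have hVi : ∫ x, V x * (t * p x + s * m x) ^ 2 =
      t ^ 2 * (∫ x, V x * p x ^ 2) + s ^ 2 * ∫ x, V x * m x ^ 2 := by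
    simp only [mul_sq_comb hdisj]
    rw [integral_add (hp.2.2.const_mul _) (hm.2.2.const_mul _), integral_const_mul,
      integral_const_mul]
  have hgi := integral_gagForm_comb_self hp.1 hm.1 hp.2.1 hm.2.1 t s
  rw [Jfun, normSq_toReal hV0 hw.2.1 hw.2.2, hK, hVi, hgi, fiberEnergy,
    normSq_toReal hV0 hp.2.1 hp.2.2, normSq_toReal hV0 hm.2.1 hm.2.2]
  ring

lemma Jd_comb_left (hV : Measurable V) (hV0 : ∀ x, 0 < V x) (hp : memX α V p) (hm : memX α V m)
    (t s : ℝ) :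
    Jd α V K f (fun x => t * p x + s * m x) p =
      t * (normSq α V p).toReal + s * (∫ z, gagForm α p m z) -
        ∫ x, K x * f (t * p x) * p x := by
  rw [memX_iff hV hV0] at hp hm
  have hK : ∫ x, K x * f (t * p x + s * m x) * p x = ∫ x, K x * f (t * p x) * p x := by
    congr 1
    ext x
    rcases hdisj x with h | h <;> simp [h]
  have hVi : ∫ x, V x * (t * p x + s * m x) * p x = t * ∫ x, V x * p x ^ 2 := by
    rw [← integral_const_mul]
    congr 1
    ext x
    rcases hdisj x with h | h <;> rw [h] <;> ring
  have hgi : ∫ z, gagForm α (fun x => t * p x + s * m x) p z =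
      t * (∫ z, gagForm α p p z) + s * ∫ z, gagForm α p m z := by
    simp only [gagForm_comb_left, gagForm_comm m p]
    rw [integral_add (hp.2.1.const_mul _)
      ((integrable_gagForm hp.1 hm.1 hp.2.1 hm.2.1).const_mul _),
      integral_const_mul, integral_const_mul]
  change (∫ z, gagForm α (fun x => t * p x + s * m x) p z) + _ - _ = _
  rw [hK, hVi, hgi, normSq_toReal hV0 hp.2.1 hp.2.2]
  ring

lemma Jd_comb_right (hV : Measurable V) (hV0 : ∀ x, 0 < V x) (hp : memX α V p) (hm : memX α V m)
    (t s : ℝ) :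
    Jd α V K f (fun x => t * p x + s * m x) m =
      s * (normSq α V m).toReal + t * (∫ z, gagForm α p m z) -
        ∫ x, K x * f (s * m x) * m x := by
  simp only [add_comm (t * _), gagForm_comm p m]
  rw [Jd_comb_left (fun x => (hdisj x).symm) hV hV0 hm hp s t, add_comm]

lemma Jd_comb_self (hV : Measurable V) (hV0 : ∀ x, 0 < V x) (hp : memX α V p) (hm : memX α V m)
    (t s : ℝ) (hip : Integrable fun x => K x * f (t * p x) * p x)
    (him : Integrable fun x => K x * f (s * m x) * m x) :
    Jd α V K f (fun x => t * p x + s * m x) (fun x => t * p x + s * m x) =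
      t * Jd α V K f (fun x => t * p x + s * m x) p +
        s * Jd α V K f (fun x => t * p x + s * m x) m := by
  rw [Jd_comb_left hdisj hV hV0 hp hm, Jd_comb_right hdisj hV hV0 hp hm]
  rw [memX_iff hV hV0] at hp hm
  have hK : ∫ x, K x * f (t * p x + s * m x) * (t * p x + s * m x) =
      t * (∫ x, K x * f (t * p x) * p x) + s * ∫ x, K x * f (s * m x) * m x := by
    rw [← integral_const_mul, ← integral_const_mul,
      ← integral_add (hip.const_mul _) (him.const_mul _)]
    congr 1
    ext x
    rcases hdisj x with h | h <;> simp [h] <;> ring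
  have hVi : ∫ x, V x * (t * p x + s * m x) * (t * p x + s * m x) =
      t ^ 2 * (∫ x, V x * p x ^ 2) + s ^ 2 * ∫ x, V x * m x ^ 2 := by
    rw [← integral_const_mul, ← integral_const_mul,
      ← integral_add (hp.2.2.const_mul _) (hm.2.2.const_mul _)]
    congr 1
    ext x
    rw [← mul_sq_comb hdisj]
    ring
  have hgi := integral_gagForm_comb_self hp.1 hm.1 hp.2.1 hm.2.1 t s
  change (∫ z, gagForm α (fun x => t * p x + s * m x) (fun x => t * p x + s * m x) z) + _ - _ = _
  rw [hK, hVi, hgi, normSq_toReal hV0 hp.2.1 hp.2.2, normSq_toReal hV0 hm.2.1 hm.2.2]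
  ring

end Splitting

section Parts

variable {N : ℕ} {α : ℝ} {V : EN N → ℝ} {u : EN N → ℝ}

lemma uplus_eq_zero_or_uminus_eq_zero (u : EN N → ℝ) (x : EN N) : uplus u x = 0 ∨ uminus u x = 0 :=
  (le_total (u x) 0).imp max_eq_right min_eq_right

lemma uplus_comb {t s : ℝ} (ht : 0 ≤ t) (hs : 0 ≤ s) :
    uplus (fun x => t * uplus u x + s * uminus u x) = fun x => t * uplus u x := by
  ext x
  have h1 : 0 ≤ t * uplus u x := mul_nonneg ht (le_max_right _ _)
  have h2 : s * uminus u x ≤ 0 := mul_nonpos_of_nonneg_of_nonpos hs (min_le_right _ _)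
  change max (t * uplus u x + s * uminus u x) 0 = _
  rcases uplus_eq_zero_or_uminus_eq_zero u x with h | h
  · simp [h, h2]
  · simp [h, h1]

lemma uminus_comb {t s : ℝ} (ht : 0 ≤ t) (hs : 0 ≤ s) :
    uminus (fun x => t * uplus u x + s * uminus u x) = fun x => s * uminus u x := by
  ext x
  have h1 : 0 ≤ t * uplus u x := mul_nonneg ht (le_max_right _ _)
  have h2 : s * uminus u x ≤ 0 := mul_nonpos_of_nonneg_of_nonpos hs (min_le_right _ _)
  change min (t * uplus u x + s * uminus u x) 0 = _
  rcases uplus_eq_zero_or_uminus_eq_zero u x with h | h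
  · simp [h, h2]
  · simp [h, h1]

lemma NotAEZero.const_mul {v : EN N → ℝ} (hv : NotAEZero v) {t : ℝ} (ht : t ≠ 0) :
    NotAEZero fun x => t * v x := by
  refine fun h => hv ?_
  filter_upwards [h] with x hx
  exact (mul_eq_zero.1 hx).resolve_left ht

lemma NotAEZero.of_uplus {v : EN N → ℝ} (hv : NotAEZero (uplus v)) : NotAEZero v := by
  refine fun h => hv ?_
  filter_upwards [h] with x hx
  simp [uplus, hx]

lemma normSq_toReal_pos (hV : Measurable V) (hV0 : ∀ x, 0 < V x) (hu : memX α V u)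
    (h0 : NotAEZero u) : 0 < (normSq α V u).toReal := by
  obtain ⟨-, hg, hi⟩ := (memX_iff hV hV0).1 hu
  rw [normSq_toReal hV0 hg hi]
  refine add_pos_of_nonneg_of_pos (integral_nonneg (gagForm_self_nonneg α u)) ?_
  rw [integral_pos_iff_support_of_nonneg (fun x => mul_nonneg (hV0 x).le (sq_nonneg _)) hi,
    pos_iff_ne_zero]
  refine fun h => h0 (ae_iff.2 (measure_mono_null (fun x hx => ?_) h))
  have h1 : u x ≠ 0 := hx
  have := hV0 x
  simp only [Function.mem_support]
  positivity

end Parts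

end ZeroMass

/-- Lemma 4.1(ii): there is a unique pair `(t₊, s₋)` of positive numbers with
`t₊u⁺ + s₋u⁻ ∈ M`, and it is the unique global maximum point of
`(t,s) ↦ J(tu⁺ + su⁻)` on `[0,∞) × [0,∞)`. -/
theorem statement16 {N : ℕ} (α : ℝ) (hα : α ∈ Set.Ioo (0 : ℝ) 1) (hN : 2 * α < N)
    (V K : EN N → ℝ) (f : ℝ → ℝ)
    (hV : Continuous V) (hK : Continuous K) (hf : Continuous f)
    (h1 : H1 V K) (h2 : H2 K) (h3 : H3 V K)
    (hf1 : Cf1 f) (hf2 : Cf2 f (critExp N α)) (hf3 : Cf3 f) (hf4 : Cf4 f)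
    (u : EN N → ℝ) (hu : memX α V u)
    (hup : NotAEZero (uplus u)) (hum : NotAEZero (uminus u)) :
    ∃ tp sm : ℝ, 0 < tp ∧ 0 < sm ∧
      memM α V K f (fun x => tp * uplus u x + sm * uminus u x) ∧
      Jd α V K f (fun x => tp * uplus u x + sm * uminus u x) (uplus u) = 0 ∧
      Jd α V K f (fun x => tp * uplus u x + sm * uminus u x) (uminus u) = 0 ∧
      (∀ t s : ℝ, 0 < t → 0 < s →
        Jd α V K f (fun x => t * uplus u x + s * uminus u x) (uplus u) = 0 →
        Jd α V K f (fun x => t * uplus u x + s * uminus u x) (uminus u) = 0 →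
        t = tp ∧ s = sm) ∧
      (∀ t s : ℝ, 0 ≤ t → 0 ≤ s → (t, s) ≠ (tp, sm) →
        Jfun α V K f (fun x => t * uplus u x + s * uminus u x) <
          Jfun α V K f (fun x => tp * uplus u x + sm * uminus u x)) := by

  obtain ⟨hV0, hK0, -⟩ := id h1
  have hα0 := hα.1
  have hq := two_lt_critExp hα0 hN
  have hq1 : 1 < critExp N α := by linarith
  have h0 := apply_zero hf hf1 hf4
  have hVm := hV.measurable
  have hXp : memX α V (uplus u) := memX_of_contraction hVm hV0 hu (θ := fun a => max a 0)
    (fun a b => abs_max_sub_max_le_abs a b 0) (max_self 0)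
  have hXm : memX α V (uminus u) := memX_of_contraction hVm hV0 hu (θ := fun a => min a 0)
    (fun a b => by simpa using abs_min_sub_min_le_max a 0 b 0) (min_self 0)
  have hdisj := uplus_eq_zero_or_uminus_eq_zero u
  have hKsq : ∀ v, memX α V v → Integrable fun x => K x * v x ^ 2 := fun v hv =>
    integrable_mul_sq hV0 hK0 hK.measurable h3 hv.1 ((memX_iff hVm hV0).1 hv).2.2
  have hKq : ∀ v, memX α V v → Integrable fun x => K x * |v x| ^ critExp N α := fun v hv =>
    integrable_mul_critExp hα0 hN hV hK h1 h3 hv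
  have hF : ∀ v, memX α V v → ∀ t, Integrable fun x => K x * prim f (t * v x) := fun v hv =>
    integrable_fiber hf hq1 hK0 hK.measurable hv.1 (hKsq v hv) (hKq v hv) h0 hf1 hf2
  have hf' : ∀ v, memX α V v → ∀ t, Integrable fun x => K x * f (t * v x) * v x := fun v hv =>
    integrable_fiber_deriv hf hq1 hK0 hK.measurable hv.1 (hKsq v hv) (hKq v hv) h0 hf1 hf2
  have hfib : ∀ v, memX α V v → NotAEZero v → IsFiber (fun t => ∫ x, K x * prim f (t * v x))
      (fun t => ∫ x, K x * f (t * v x) * v x) := fun v hv hv0 =>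
    isFiber_integral hf hq hK0 hK.measurable hv.1 (hKsq v hv) (hKq v hv) hf1 hf2 hf3 hf4 hv0
  have hD : 0 ≤ ∫ z, gagForm α (uplus u) (uminus u) z :=
    integral_nonneg (gagForm_nonneg_of_disjoint hdisj (fun x => le_max_right _ _)
      (fun x => min_le_right _ _))
  obtain ⟨tp, sm, htp, hsm, e1, e2, huniq, hmax⟩ := exists_unique_critical
    (normSq_toReal_pos hVm hV0 hXp hup) (normSq_toReal_pos hVm hV0 hXm hum) hD
    (hfib _ hXp hup) (hfib _ hXm hum)
  have hJp := Jd_comb_left (K := K) (f := f) hdisj hVm hV0 hXp hXm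
  have hJm := Jd_comb_right (K := K) (f := f) hdisj hVm hV0 hXp hXm
  have c1 := (hJp tp sm).trans (sub_eq_zero.2 e1)
  have c2 := (hJm tp sm).trans (sub_eq_zero.2 e2)
  have hupw := uplus_comb (u := u) htp.le hsm.le
  have humw := uminus_comb (u := u) htp.le hsm.le
  have hup' : NotAEZero (uplus fun x => tp * uplus u x + sm * uminus u x) :=
    hupw ▸ hup.const_mul htp.ne'
  refine ⟨tp, sm, htp, hsm, ⟨⟨memX_comb hdisj hVm hV0 hXp hXm tp sm, hup'.of_uplus, ?_⟩, hup',
    humw ▸ hum.const_mul hsm.ne', ?_, ?_⟩, c1, c2, fun t s ht hs h1 h2 => ?_,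
    fun t s ht hs hne => ?_⟩
  · rw [Jd_comb_self hdisj hVm hV0 hXp hXm tp sm (hf' _ hXp tp) (hf' _ hXm sm), c1, c2, mul_zero,
      mul_zero, add_zero]
  · rw [hupw, Jd_const_mul, c1, mul_zero]
  · rw [humw, Jd_const_mul, c2, mul_zero]
  · exact huniq t s ht hs (sub_eq_zero.1 ((hJp t s).symm.trans h1))
      (sub_eq_zero.1 ((hJm t s).symm.trans h2))
  · rw [Jfun_comb hdisj hVm hV0 hXp hXm t s (hF _ hXp t) (hF _ hXm s),
      Jfun_comb hdisj hVm hV0 hXp hXm tp sm (hF _ hXp tp) (hF _ hXm sm)]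
    exact hmax t s ht hs hne
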